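/- Assume the sequence R_1, …, R_m is disjoint-superset and d_i ≥ 1 for every i. Then for every f with 1 ≤ f ≤ m and every coin c ∈ R_f, one has Pr_f(c) > 0 and Pr_f(r_f | c) = (1 − p) / ((d_f − 1)·p + 1), where p = Pr_{f−1}(c). -/

import Mathlib

open scoped Classical

/-- The spent coin permutations for the first `k` ring signatures of the
sequence `R` (rings are indexed from `1`): injective functions `σ : Fin k → C`
with `σ(j) ∈ R_j` for each `j ∈ {1, …, k}` (position `j` of `σ` is `j - 1`). -/
noncomputable def perms {C : Type*} [Fintype C] [DecidableEq C]
    (R : ℕ → Finset C) (k : ℕ) : Finset (Fin k → C) :=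
  Finset.univ.filter fun σ => Function.Injective σ ∧ ∀ j : Fin k, σ j ∈ R (j.1 + 1)

/-- `N_k`, the number of spent coin permutations for the first `k` ring signatures. -/
noncomputable def numPerms {C : Type*} [Fintype C] [DecidableEq C]
    (R : ℕ → Finset C) (k : ℕ) : ℕ :=
  (perms R k).card

/-- `Pr_k(c, r_j)`: the fraction of spent coin permutations `σ` for the first `k`
ring signatures with `σ(j) = c`. -/
noncomputable def prSpentIn {C : Type*} [Fintype C] [DecidableEq C]
    (R : ℕ → Finset C) (k j : ℕ) (c : C) : ℝ :=
  (((perms R k).filter fun σ => ∃ h : j - 1 < k, σ ⟨j - 1, h⟩ = c).card : ℝ) /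
    (numPerms R k : ℝ)

/-- `Pr_k(c)`: the fraction of spent coin permutations `σ` for the first `k`
ring signatures having `c` in their image. -/
noncomputable def prSpent {C : Type*} [Fintype C] [DecidableEq C]
    (R : ℕ → Finset C) (k : ℕ) (c : C) : ℝ :=
  (((perms R k).filter fun σ => ∃ j, σ j = c).card : ℝ) / (numPerms R k : ℝ)

/-- `Pr_k(r_j | c) = Pr_k(c, r_j) / Pr_k(c)`. -/
noncomputable def prCond {C : Type*} [Fintype C] [DecidableEq C]
    (R : ℕ → Finset C) (k j : ℕ) (c : C) : ℝ :=
  prSpentIn R k j c / prSpent R k c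

/-- The first `m` ring signatures of `R` are disjoint-superset: for all
`1 ≤ j < i ≤ m`, either `R_i ∩ R_j = ∅` or `R_j ⊆ R_i`. -/
def DisjointSuperset {C : Type*} [Fintype C] [DecidableEq C]
    (R : ℕ → Finset C) (m : ℕ) : Prop :=
  ∀ i j, 1 ≤ j → j < i → i ≤ m → Disjoint (R i) (R j) ∨ R j ⊆ R i

/-- `ns_i`: the number of indices `j < i` with `R_j ⊆ R_i`. -/
noncomputable def nsub {C : Type*} [Fintype C] [DecidableEq C]
    (R : ℕ → Finset C) (i : ℕ) : ℕ :=
  ((Finset.Ico 1 i).filter fun j => R j ⊆ R i).card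

/-- The degree `d_i = |R_i| - ns_i`. -/
noncomputable def deg {C : Type*} [Fintype C] [DecidableEq C]
    (R : ℕ → Finset C) (i : ℕ) : ℕ :=
  (R i).card - nsub R i

theorem mem_perms {C : Type*} [Fintype C] [DecidableEq C] {R : ℕ → Finset C} {k : ℕ}
    {σ : Fin k → C} :
    σ ∈ perms R k ↔ Function.Injective σ ∧ ∀ j : Fin k, σ j ∈ R (j.1 + 1) := by
  simp [perms]

theorem snoc_mem_perms {C : Type*} [Fintype C] [DecidableEq C] {R : ℕ → Finset C} {n : ℕ}
    {σ : Fin n → C} {x : C} :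
    (Fin.snoc σ x : Fin (n + 1) → C) ∈ perms R (n + 1) ↔
      σ ∈ perms R n ∧ x ∈ R (n + 1) ∧ ∀ j, σ j ≠ x := by
  rw [mem_perms, mem_perms, Fin.snoc_injective_iff, Fin.forall_fin_succ']
  simp only [Fin.snoc_castSucc, Fin.snoc_last, Fin.val_castSucc, Fin.val_last, Set.mem_range,
    not_exists]
  tauto

theorem init_mem_perms {C : Type*} [Fintype C] [DecidableEq C] {R : ℕ → Finset C} {n : ℕ}
    {τ : Fin (n + 1) → C} (hτ : τ ∈ perms R (n + 1)) :
    (Fin.init τ : Fin n → C) ∈ perms R n := by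
  rw [← Fin.snoc_init_self τ] at hτ
  exact (snoc_mem_perms.1 hτ).1

/-- Every spent coin permutation uses exactly `ns_{n+1}` coins of the next ring. -/
theorem card_inter_image {C : Type*} [Fintype C] [DecidableEq C] {R : ℕ → Finset C} {n m : ℕ}
    (hds : DisjointSuperset R m) (hn : n + 1 ≤ m) {σ : Fin n → C} (hσ : σ ∈ perms R n) :
    (Finset.univ.image σ ∩ R (n + 1)).card = nsub R (n + 1) := by
  obtain ⟨hinj, hmem⟩ := mem_perms.1 hσ
  have himage : Finset.univ.image σ ∩ R (n + 1) =
      (Finset.univ.filter fun j : Fin n => R (j.1 + 1) ⊆ R (n + 1)).image σ := by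
    ext x
    simp only [Finset.mem_inter, Finset.mem_image, Finset.mem_univ, true_and, Finset.mem_filter]
    constructor
    · rintro ⟨⟨j, rfl⟩, hx⟩
      refine ⟨j, ?_, rfl⟩
      rcases hds (n + 1) (j.1 + 1) (by omega) (by omega) hn with h | h
      · exact absurd (hmem j) (Finset.disjoint_left.1 h hx)
      · exact h
    · rintro ⟨j, hj, rfl⟩
      exact ⟨⟨j, rfl⟩, hj (hmem j)⟩
  rw [himage, Finset.card_image_of_injective _ hinj, nsub]
  refine Finset.card_bij (fun j _ => j.1 + 1) ?_ ?_ ?_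
  · intro j hj
    simp only [Finset.mem_filter, Finset.mem_univ, true_and] at hj
    simp only [Finset.mem_filter, Finset.mem_Ico]
    exact ⟨⟨by omega, by omega⟩, hj⟩
  · intro a _ b _ h
    exact Fin.ext (by omega)
  · intro b hb
    simp only [Finset.mem_filter, Finset.mem_Ico] at hb
    have hb' : b - 1 + 1 = b := by omega
    refine ⟨⟨b - 1, by omega⟩, ?_, hb'⟩
    simp only [Finset.mem_filter, Finset.mem_univ, true_and]
    rw [hb']
    exact hb.2

/-- Every spent coin permutation has exactly `d_{n+1}` extensions by one more ring. -/
theorem card_extensions {C : Type*} [Fintype C] [DecidableEq C] {R : ℕ → Finset C} {n m : ℕ}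
    (hds : DisjointSuperset R m) (hn : n + 1 ≤ m) {σ : Fin n → C} (hσ : σ ∈ perms R n) :
    ((perms R (n + 1)).filter fun τ => (Fin.init τ : Fin n → C) = σ).card = deg R (n + 1) := by
  have himage : ((perms R (n + 1)).filter fun τ => (Fin.init τ : Fin n → C) = σ) =
      (R (n + 1) \ Finset.univ.image σ).image fun x => (Fin.snoc σ x : Fin (n + 1) → C) := by
    ext τ
    simp only [Finset.mem_filter, Finset.mem_image, Finset.mem_sdiff, Finset.mem_univ, true_and,
      not_exists]
    constructor
    · rintro ⟨hτ, rfl⟩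
      have h := hτ
      rw [← Fin.snoc_init_self τ] at h
      exact ⟨τ (Fin.last n), (snoc_mem_perms.1 h).2, Fin.snoc_init_self τ⟩
    · rintro ⟨x, hx, rfl⟩
      exact ⟨snoc_mem_perms.2 ⟨hσ, hx⟩, Fin.init_snoc (α := fun _ => C) x σ⟩
  have hinj : Function.Injective fun x => (Fin.snoc σ x : Fin (n + 1) → C) := by
    intro x y h
    simpa using congrFun h (Fin.last n)
  rw [himage, Finset.card_image_of_injective _ hinj, Finset.card_sdiff,
    card_inter_image hds hn hσ, deg]

theorem card_filter_init {C : Type*} [Fintype C] [DecidableEq C] {R : ℕ → Finset C} {n m : ℕ}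
    (hds : DisjointSuperset R m) (hn : n + 1 ≤ m) (P : (Fin n → C) → Prop)
    [DecidablePred P] :
    ((perms R (n + 1)).filter fun τ => P (Fin.init τ)).card =
      ((perms R n).filter P).card * deg R (n + 1) := by
  rw [Finset.card_eq_sum_card_fiberwise (f := fun τ => (Fin.init τ : Fin n → C))
    (t := (perms R n).filter P)]
  · refine Finset.sum_const_nat fun σ hσ => ?_
    rw [Finset.mem_filter] at hσ
    rw [← card_extensions hds hn hσ.1, Finset.filter_filter]
    congr 1
    refine Finset.filter_congr fun τ _ => ⟨fun h => h.2, ?_⟩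
    rintro rfl
    exact ⟨hσ.2, rfl⟩
  · intro τ hτ
    have hτ' := Finset.mem_filter.1 (Finset.mem_coe.1 hτ)
    exact Finset.mem_coe.2 (Finset.mem_filter.2 ⟨init_mem_perms hτ'.1, hτ'.2⟩)

theorem numPerms_succ {C : Type*} [Fintype C] [DecidableEq C] {R : ℕ → Finset C} {n m : ℕ}
    (hds : DisjointSuperset R m) (hn : n + 1 ≤ m) :
    numPerms R (n + 1) = numPerms R n * deg R (n + 1) := by
  simpa [numPerms] using card_filter_init hds hn fun _ => True

theorem numPerms_pos {C : Type*} [Fintype C] [DecidableEq C] {R : ℕ → Finset C} {m : ℕ}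
    (hds : DisjointSuperset R m) (hdeg : ∀ i, 1 ≤ i → i ≤ m → 1 ≤ deg R i) {n : ℕ}
    (hn : n ≤ m) : 0 < numPerms R n := by
  induction n with
  | zero =>
    exact Finset.card_pos.2 ⟨Fin.elim0, mem_perms.2 ⟨fun a => a.elim0, fun a => a.elim0⟩⟩
  | succ n ih =>
    rw [numPerms_succ hds hn]
    exact Nat.mul_pos (ih (by omega)) (hdeg _ (by omega) hn)

theorem card_filter_last {C : Type*} [Fintype C] [DecidableEq C] {R : ℕ → Finset C} {n : ℕ}
    {c : C} (hc : c ∈ R (n + 1)) :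
    ((perms R (n + 1)).filter fun τ => τ (Fin.last n) = c).card =
      ((perms R n).filter fun σ => ¬ ∃ j, σ j = c).card := by
  symm
  refine Finset.card_bij (fun σ _ => (Fin.snoc σ c : Fin (n + 1) → C)) ?_ ?_ ?_
  · intro σ hσ
    rw [Finset.mem_filter] at hσ ⊢
    exact ⟨snoc_mem_perms.2 ⟨hσ.1, hc, not_exists.1 hσ.2⟩, Fin.snoc_last (α := fun _ => C) c σ⟩
  · intro σ _ σ' _ h
    have h' := congrArg (fun τ : Fin (n + 1) → C => (Fin.init τ : Fin n → C)) h
    simpa using h'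
  · intro τ hτ
    obtain ⟨h, rfl⟩ := Finset.mem_filter.1 hτ
    rw [← Fin.snoc_init_self τ] at h
    obtain ⟨h₁, -, h₂⟩ := snoc_mem_perms.1 h
    exact ⟨Fin.init τ, Finset.mem_filter.2 ⟨h₁, not_exists.2 h₂⟩, Fin.snoc_init_self τ⟩

theorem card_filter_spent_succ {C : Type*} [Fintype C] [DecidableEq C] {R : ℕ → Finset C}
    {n m : ℕ} (hds : DisjointSuperset R m) (hn : n + 1 ≤ m) {c : C} (hc : c ∈ R (n + 1)) :
    ((perms R (n + 1)).filter fun τ => ∃ j, τ j = c).card =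
      ((perms R n).filter fun σ => ∃ j, σ j = c).card * deg R (n + 1) +
        ((perms R n).filter fun σ => ¬ ∃ j, σ j = c).card := by
  rw [← card_filter_init hds hn fun σ => ∃ j, σ j = c, ← card_filter_last hc, ← Finset.card_union_of_disjoint]
  · rw [← Finset.filter_or]
    congr 1
    refine Finset.filter_congr fun τ _ => ?_
    rw [Fin.exists_fin_succ']
    rfl
  · rw [Finset.disjoint_filter]
    rintro τ hτ ⟨j, hj⟩ hl
    have h := (mem_perms.1 hτ).1 (hj.trans hl.symm)
    exact absurd h (Fin.castSucc_lt_last j).ne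

theorem stmt12 {C : Type*} [Fintype C] [DecidableEq C]
    (R : ℕ → Finset C) (m : ℕ)
    (hne : ∀ i, 1 ≤ i → i ≤ m → (R i).Nonempty)
    (hds : DisjointSuperset R m)
    (hdeg : ∀ i, 1 ≤ i → i ≤ m → 1 ≤ deg R i) :
    ∀ f, 1 ≤ f → f ≤ m → ∀ c ∈ R f,
      0 < prSpent R f c ∧
      prCond R f f c =
        (1 - prSpent R (f - 1) c) /
          (((deg R f : ℝ) - 1) * prSpent R (f - 1) c + 1) := by
  rintro f hf hfm c hc
  obtain ⟨n, rfl⟩ : ∃ n, f = n + 1 := ⟨f - 1, by omega⟩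
  have hN := numPerms_pos hds hdeg (n := n) (by omega)
  have hd := hdeg (n + 1) hf hfm
  have hsplit := Finset.card_filter_add_card_filter_not (s := perms R n)
    (fun σ => ∃ j, σ j = c)
  have hspent := card_filter_spent_succ hds hfm hc
  have hlast : ((perms R (n + 1)).filter fun τ =>
      ∃ h : n + 1 - 1 < n + 1, τ ⟨n + 1 - 1, h⟩ = c).card =
      ((perms R n).filter fun σ => ¬ ∃ j, σ j = c).card := by
    rw [← card_filter_last hc]
    congr 1
    exact Finset.filter_congr fun τ _ => ⟨fun ⟨_, h⟩ => h, fun h => ⟨by omega, h⟩⟩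
  rw [show prSpent R (n + 1 - 1) c = prSpent R n c from rfl]
  simp only [prCond, prSpentIn, prSpent, Nat.add_sub_cancel] at hlast ⊢
  rw [hspent, hlast, numPerms_succ hds hfm]
  change _ = numPerms R n at hsplit
  rw [← hsplit] at hN ⊢
  generalize ((perms R n).filter fun σ => ∃ j, σ j = c).card = a at *
  generalize ((perms R n).filter fun σ => ¬ ∃ j, σ j = c).card = b at *
  generalize deg R (n + 1) = d at *
  have hN' : (0 : ℝ) < a + b := by exact_mod_cast hN
  have hd' : (1 : ℝ) ≤ d := by exact_mod_cast hd
  have ha : (0 : ℝ) ≤ a := a.cast_nonneg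
  have hpos : (0 : ℝ) < a * d + b := by nlinarith
  have hd₀ : (0 : ℝ) < d := by linarith
  push_cast
  refine ⟨by positivity, ?_⟩
  have hnum : 1 - (a : ℝ) / (a + b) = b / (a + b) := by
    field_simp
    ring
  have hden : ((d : ℝ) - 1) * (a / (a + b)) + 1 = (a * d + b) / (a + b) := by
    field_simp
    ring
  rw [hnum, hden, div_div_div_cancel_right₀ hN'.ne',
    div_div_div_cancel_right₀ (mul_pos hN' hd₀).ne']
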